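/- The map H : B_1 × B_1 → ℤ defined by H(x⊗y) = 0 if (x,y) ∈ 𝐀, H(x⊗y) = 2 if (x,y) ∈ 𝐁, and H(x⊗y) = 1 otherwise, is an energy function on B_1 ⊗ B_1: for every i ∈ {0,1,2} and every pair (b_1, b_2) ∈ B_1 × B_1 with f̃_i(b_1⊗b_2) ≠ 0, one has H(f̃_i(b_1⊗b_2)) = H(b_1⊗b_2) if i ∈ {1,2}; H(f̃_0(b_1⊗b_2)) = H(b_1⊗b_2) − 1 if φ_0(b_1) > ε_0(b_2); and H(f̃_0(b_1⊗b_2)) = H(b_1⊗b_2) + 1 if φ_0(b_1) ≤ ε_0(b_2). -/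

import Mathlib

/-!
The level-1 perfect crystal `B₁` of `U_q(D₄⁽³⁾)` with index set `{0,1,2}` (as `Fin 3`),
its Kashiwara operators (with `Option`, `none` playing the role of `0`),
the string functions `ε_i(b) = max{n : ẽ_iⁿ b ≠ 0}`, `φ_i(b) = max{n : f̃_iⁿ b ≠ 0}`,
the tensor product rule, the subsets `𝐀`, `𝐁`, and the energy function `H`.
-/

namespace D43

/-- The level-1 perfect crystal `B₁ = {u₁, u₂, u₃, u₀, u₃̄, u₂̄, u₁̄, u_φ}` of `U_q(D₄⁽³⁾)`. -/
inductive B1 : Type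
  | u1 | u2 | u3 | u0 | u3b | u2b | u1b | uphi
  deriving DecidableEq

open B1

/-- The Kashiwara operator `f̃_1`. -/
def f1 : B1 → Option B1
  | u1 => some u2
  | u3 => some u0
  | u0 => some u3b
  | u2b => some u1b
  | _ => none

/-- The Kashiwara operator `f̃_2`. -/
def f2 : B1 → Option B1
  | u2 => some u3
  | u3b => some u2b
  | _ => none

/-- The Kashiwara operator `f̃_0`. -/
def f0 : B1 → Option B1
  | u2b => some u3
  | u3b => some u2
  | u1b => some uphi
  | uphi => some u1
  | _ => none

/-- The Kashiwara operators `f̃_i`, `i ∈ {0,1,2}`. -/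
def fK : Fin 3 → B1 → Option B1 :=
  fun i => if i = 0 then f0 else if i = 1 then f1 else f2

/-- The Kashiwara operator `ẽ_1`, the partial inverse of `f̃_1`. -/
def e1 : B1 → Option B1
  | u2 => some u1
  | u0 => some u3
  | u3b => some u0
  | u1b => some u2b
  | _ => none

/-- The Kashiwara operator `ẽ_2`, the partial inverse of `f̃_2`. -/
def e2 : B1 → Option B1
  | u3 => some u2
  | u2b => some u3b
  | _ => none

/-- The Kashiwara operator `ẽ_0`, the partial inverse of `f̃_0`. -/
def e0 : B1 → Option B1
  | u3 => some u2b
  | u2 => some u3b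
  | uphi => some u1b
  | u1 => some uphi
  | _ => none

/-- The Kashiwara operators `ẽ_i`, `i ∈ {0,1,2}`. -/
def eK : Fin 3 → B1 → Option B1 :=
  fun i => if i = 0 then e0 else if i = 1 then e1 else e2

/-- `f̃_iⁿ`. -/
def fIter (i : Fin 3) : ℕ → B1 → Option B1
  | 0, b => some b
  | n + 1, b => (fK i b).bind (fIter i n)

/-- `ẽ_iⁿ`. -/
def eIter (i : Fin 3) : ℕ → B1 → Option B1
  | 0, b => some b
  | n + 1, b => (eK i b).bind (eIter i n)

/-- `φ_i(b) = max{n ≥ 0 : f̃_iⁿ b ≠ 0}`. -/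
noncomputable def phiK (i : Fin 3) (b : B1) : ℤ :=
  ((sSup {n : ℕ | fIter i n b ≠ none} : ℕ) : ℤ)

/-- `ε_i(b) = max{n ≥ 0 : ẽ_iⁿ b ≠ 0}`. -/
noncomputable def epsK (i : Fin 3) (b : B1) : ℤ :=
  ((sSup {n : ℕ | eIter i n b ≠ none} : ℕ) : ℤ)

/-- The tensor product rule: `f̃_i(b ⊗ b') = (f̃_i b) ⊗ b'` if `φ_i(b) > ε_i(b')`,
and `b ⊗ (f̃_i b')` if `φ_i(b) ≤ ε_i(b')` (with `0 ⊗ b' = b ⊗ 0 = 0`). -/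
noncomputable def tensF (i : Fin 3) (p : B1 × B1) : Option (B1 × B1) :=
  if epsK i p.2 < phiK i p.1
    then (fK i p.1).map (fun c => (c, p.2))
    else (fK i p.2).map (fun c => (p.1, c))

def A0 : Set B1 := {u0, u1, u2, u3}
def Abar0 : Set B1 := {u0, u1b, u2b, u3b}
def A1 : Set B1 := {u1, u2, u3, u0, u3b, u2b, u1b}
def A2 : Set B1 := {u2, u3, u0, u3b, u2b}
def A3 : Set B1 := {u3, u0, u3b}

/-- `𝐀 = {(u_φ, u_φ), (u₂, u₂̄)} ∪ A₀ × {u₁̄} ∪ {u₁} × Ā₀`. -/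
def setA : Set (B1 × B1) :=
  {(uphi, uphi), (u2, u2b)} ∪ A0 ×ˢ ({u1b} : Set B1) ∪ ({u1} : Set B1) ×ˢ Abar0

/-- `𝐁 = ⋃_{i=1}^{3} (A_i × {u_i} ∪ {u_ī} × A_i)`. -/
def setB : Set (B1 × B1) :=
  (A1 ×ˢ ({u1} : Set B1) ∪ ({u1b} : Set B1) ×ˢ A1) ∪
  (A2 ×ˢ ({u2} : Set B1) ∪ ({u2b} : Set B1) ×ˢ A2) ∪
  (A3 ×ˢ ({u3} : Set B1) ∪ ({u3b} : Set B1) ×ˢ A3)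

open Classical in
/-- The energy function: `H(x⊗y) = 0` if `(x,y) ∈ 𝐀`, `= 2` if `(x,y) ∈ 𝐁`, `= 1` otherwise. -/
noncomputable def H : B1 × B1 → ℤ := fun p =>
  if p ∈ setA then 0 else if p ∈ setB then 2 else 1


instance : Fintype B1 where
  elems := {u1, u2, u3, u0, u3b, u2b, u1b, uphi}
  complete b := by cases b <;> decide

theorem fIter_succ_eq_none (i : Fin 3) (n : ℕ) (b : B1) (h : fIter i n b = none) :
    fIter i (n + 1) b = none := by
  induction n generalizing b with
  | zero => simp [fIter] at h
  | succ n ih =>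
    rw [fIter, Option.bind_eq_none_iff] at h ⊢
    exact fun c hc => ih c (h c hc)

theorem eIter_succ_eq_none (i : Fin 3) (n : ℕ) (b : B1) (h : eIter i n b = none) :
    eIter i (n + 1) b = none := by
  induction n generalizing b with
  | zero => simp [eIter] at h
  | succ n ih =>
    rw [eIter, Option.bind_eq_none_iff] at h ⊢
    exact fun c hc => ih c (h c hc)

theorem fIter_four (i : Fin 3) (b : B1) : fIter i 4 b = none := by
  revert i b; decide

theorem eIter_four (i : Fin 3) (b : B1) : eIter i 4 b = none := by
  revert i b; decide

/-- A set of naturals all of whose elements are at most `N` and which contains `0` has its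
supremum computed by bounded search. -/
theorem sSup_eq_findGreatest {P : ℕ → Prop} [DecidablePred P] {N : ℕ} (h0 : P 0)
    (hN : ∀ n, P n → n ≤ N) : sSup {n | P n} = Nat.findGreatest P N :=
  IsGreatest.csSup_eq ⟨Nat.findGreatest_spec (Nat.zero_le N) h0,
    fun _ hn => Nat.le_findGreatest (hN _ hn) hn⟩

theorem phiK_eq (i : Fin 3) (b : B1) :
    phiK i b = (Nat.findGreatest (fun n => fIter i n b ≠ none) 3 : ℕ) := by
  refine congrArg Nat.cast (sSup_eq_findGreatest (by simp [fIter]) fun n hn => ?_)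
  by_contra! h
  exact hn (Nat.le_induction (fIter_four i b) (fun n _ => fIter_succ_eq_none i n b) n h)

theorem epsK_eq (i : Fin 3) (b : B1) :
    epsK i b = (Nat.findGreatest (fun n => eIter i n b ≠ none) 3 : ℕ) := by
  refine congrArg Nat.cast (sSup_eq_findGreatest (by simp [eIter]) fun n hn => ?_)
  by_contra! h
  exact hn (Nat.le_induction (eIter_four i b) (fun n _ => eIter_succ_eq_none i n b) n h)

instance : DecidablePred (· ∈ setA) := fun p => by
  simp only [setA, A0, Abar0, Set.mem_union, Set.mem_prod, Set.mem_insert_iff,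
    Set.mem_singleton_iff]
  infer_instance

instance : DecidablePred (· ∈ setB) := fun p => by
  simp only [setB, A1, A2, A3, Set.mem_union, Set.mem_prod, Set.mem_insert_iff,
    Set.mem_singleton_iff]
  infer_instance

/-- `H` with its membership tests decided by computation. -/
theorem H_eq (p : B1 × B1) : H p = if p ∈ setA then 0 else if p ∈ setB then 2 else 1 := by
  unfold H
  congr

theorem H_of_mem_tensF : ∀ (i : Fin 3) (p : B1 × B1), ∀ c ∈ tensF i p,
    H c = H p + if i ≠ 0 then 0 else if epsK i p.2 < phiK i p.1 then -1 else 1 := by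
  simp only [tensF, H_eq, phiK_eq, epsK_eq]
  decide +kernel

/-- `H` is an energy function on `B₁ ⊗ B₁`. -/
theorem H_is_energy_function :
    (∀ (i : Fin 3) (b₁ b₂ c₁ c₂ : B1), i ≠ 0 → tensF i (b₁, b₂) = some (c₁, c₂) →
      H (c₁, c₂) = H (b₁, b₂)) ∧
    (∀ b₁ b₂ c₁ c₂ : B1, epsK 0 b₂ < phiK 0 b₁ →
      tensF 0 (b₁, b₂) = some (c₁, c₂) → H (c₁, c₂) = H (b₁, b₂) - 1) ∧
    (∀ b₁ b₂ c₁ c₂ : B1, phiK 0 b₁ ≤ epsK 0 b₂ →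
      tensF 0 (b₁, b₂) = some (c₁, c₂) → H (c₁, c₂) = H (b₁, b₂) + 1) := by
  refine ⟨fun i b₁ b₂ c₁ c₂ hi h => ?_, fun b₁ b₂ c₁ c₂ hlt h => ?_,
    fun b₁ b₂ c₁ c₂ hle h => ?_⟩
  · simpa [hi] using H_of_mem_tensF i (b₁, b₂) _ h
  · simpa [hlt, sub_eq_add_neg] using H_of_mem_tensF 0 (b₁, b₂) _ h
  · simpa [hle.not_gt] using H_of_mem_tensF 0 (b₁, b₂) _ h

end D43
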